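/- (Energy conservation.) Let V : ℝ × ℝ³ → ℝ³ and ρ : ℝ × ℝ³ → ℝ be twice continuously differentiable and ℤ³-periodic in the space variable, with ρ everywhere positive. Let h, ε : ℝ → ℝ be continuously differentiable with d(r·ε(r))/dr = h(r) for all r > 0. Suppose that at every (t,x) the ideal barotropic fluid equations hold: ∂ₜρ + div(ρV) = 0 and ∂ₜV + (V·∇)V = −∇(h∘ρ), where h∘ρ denotes the scalar field (t,x) ↦ h(ρ(t,x)). Then the total energy H(t) := ∫_{[0,1]³} (|V(t,x)|²/2 + ε(ρ(t,x)))·ρ(t,x) dx is constant in t. -/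

import Mathlib

open MeasureTheory

noncomputable section

/-- Points of ℝ³. -/
abbrev R3 := Fin 3 → ℝ

/-- Euclidean inner product on ℝ³. -/
def dot3 (u v : R3) : ℝ := ∑ i, u i * v i

/-- Partial derivative ∂ᵢ of a scalar field on ℝ³. -/
def pd3 (i : Fin 3) (f : R3 → ℝ) (x : R3) : ℝ := fderiv ℝ f x (Pi.single i 1)

/-- Gradient of a scalar field on ℝ³. -/
def grad3 (f : R3 → ℝ) (x : R3) : R3 := fun i => pd3 i f x

/-- Divergence of a vector field on ℝ³. -/
def div3 (V : R3 → R3) (x : R3) : ℝ := ∑ i, pd3 i (fun y => V y i) x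

/-- Curl of a vector field on ℝ³ (0-based indices). -/
def curl3 (V : R3 → R3) (x : R3) : R3 :=
  ![pd3 1 (fun y => V y 2) x - pd3 2 (fun y => V y 1) x,
    pd3 2 (fun y => V y 0) x - pd3 0 (fun y => V y 2) x,
    pd3 0 (fun y => V y 1) x - pd3 1 (fun y => V y 0) x]

/-- Cross product on ℝ³. -/
def cross3 (u v : R3) : R3 :=
  ![u 1 * v 2 - u 2 * v 1, u 2 * v 0 - u 0 * v 2, u 0 * v 1 - u 1 * v 0]

/-- Determinant of the 3×3 matrix with columns u, v, w. -/
def det3 (u v w : R3) : ℝ := Matrix.det (Matrix.transpose (Matrix.of ![u, v, w]))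

theorem hasDerivAt_setIntegral_of_contDiff {F : ℝ × R3 → ℝ} (hF : ContDiff ℝ 1 F)
    {K : Set R3} (hK : IsCompact K) (t : ℝ) :
    HasDerivAt (fun s => ∫ x in K, F (s, x)) (∫ x in K, fderiv ℝ F (t, x) (1, 0)) t := by
  have hF' : Continuous fun p : ℝ × R3 => fderiv ℝ F p (1, 0) :=
    (hF.continuous_fderiv one_ne_zero).clm_apply continuous_const
  obtain ⟨C, hC⟩ := ((isCompact_closedBall t 1).prod hK).exists_bound_of_continuousOn
    hF'.continuousOn
  refine (hasDerivAt_integral_of_dominated_loc_of_deriv_le (F := fun s x => F (s, x))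
    (F' := fun s x => fderiv ℝ F (s, x) (1, 0)) (bound := fun _ => C)
    (Metric.closedBall_mem_nhds t one_pos) ?_ ?_ ?_ ?_ ?_ ?_).2
  · refine Filter.Eventually.of_forall fun s => ?_
    exact (hF.continuous.comp (Continuous.prodMk_right s)).aestronglyMeasurable
  · exact (hF.continuous.comp (Continuous.prodMk_right t)).continuousOn.integrableOn_compact hK
  · exact (hF'.comp (Continuous.prodMk_right t)).aestronglyMeasurable
  · filter_upwards [ae_restrict_mem hK.measurableSet] with x hx s hs
    exact hC (s, x) ⟨hs, hx⟩
  · exact continuousOn_const.integrableOn_compact hK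
  · refine Filter.Eventually.of_forall fun x s _ => ?_
    exact ((hF.differentiable one_ne_zero (s, x)).hasFDerivAt).comp_hasDerivAt s
      ((hasDerivAt_id s).prodMk (hasDerivAt_const s x))

/-- The divergence of a `ℤ³`-periodic field has zero integral over the fundamental cell. -/
theorem integral_div3_eq_zero_of_periodic {G : R3 → R3} (hG : ContDiff ℝ 1 G)
    (hper : ∀ (x : R3) (k : Fin 3 → ℤ), G (x + fun i => (k i : ℝ)) = G x) :
    ∫ x in Set.Icc (0 : R3) 1, div3 G x = 0 := by
  have hGi : ∀ i, ContDiff ℝ 1 fun y => G y i := fun i => contDiff_pi.1 hG i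
  have hint : Continuous (div3 G) := continuous_finsetSum _ fun i _ =>
    ((hGi i).continuous_fderiv one_ne_zero).clm_apply continuous_const
  have key := integral_divergence_of_hasFDerivAt_off_countable' (0 : R3) 1 zero_le_one
    (fun i y => G y i) (fun i y => fderiv ℝ (fun y => G y i) y) ∅ Set.countable_empty
    (fun i => (hGi i).continuous.continuousOn)
    (fun x _ i => ((hGi i).differentiable one_ne_zero x).hasFDerivAt)
    (hint.continuousOn.integrableOn_compact isCompact_Icc)
  refine key.trans (Finset.sum_eq_zero fun i _ => sub_eq_zero.2 ?_)
  congr 1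
  funext x
  have hshift : (i.insertNth ((1 : R3) i) x : R3)
      = i.insertNth ((0 : R3) i) x + fun j => ((Pi.single i 1 : Fin 3 → ℤ) j : ℝ) := by
    funext j
    refine Fin.succAboveCases i ?_ (fun j => ?_) j <;> simp
  exact congrFun ((congrArg G hshift).trans (hper _ _)) i

theorem pd3_mul {f g : R3 → ℝ} {x : R3} (hf : DifferentiableAt ℝ f x)
    (hg : DifferentiableAt ℝ g x) (i : Fin 3) :
    pd3 i (fun y => f y * g y) x = f x * pd3 i g x + g x * pd3 i f x := by
  simp [pd3, fderiv_fun_mul hf hg]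

theorem div3_smul {f : R3 → ℝ} {W : R3 → R3} {x : R3} (hf : DifferentiableAt ℝ f x)
    (hW : DifferentiableAt ℝ W x) :
    div3 (fun y => f y • W y) x = f x * div3 W x + dot3 (W x) (grad3 f x) := by
  simp only [div3, dot3, grad3, Pi.smul_apply, smul_eq_mul, Finset.mul_sum,
    ← Finset.sum_add_distrib]
  exact Finset.sum_congr rfl fun i _ => pd3_mul hf (differentiableAt_pi.1 hW i) i

theorem pd3_dot3_self_div_two {V : R3 → R3} {x : R3} (hV : DifferentiableAt ℝ V x) (i : Fin 3) :
    pd3 i (fun y => dot3 (V y) (V y) / 2) x = ∑ j, V x j * pd3 i (fun y => V y j) x := by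
  have hj := fun j => (differentiableAt_pi.1 hV j).hasFDerivAt
  have h : HasFDerivAt (fun y => (∑ j, V y j * V y j) * (1 / 2)) _ x :=
    (HasFDerivAt.fun_sum (u := Finset.univ) fun j _ => (hj j).mul (hj j)).mul_const (1 / 2)
  have hfun : (fun y => dot3 (V y) (V y) / 2) = fun y => (∑ j, V y j * V y j) * (1 / 2) :=
    funext fun y => div_eq_mul_one_div _ _
  rw [pd3, hfun, h.fderiv]
  simp [pd3, Finset.mul_sum]
  refine Finset.sum_congr rfl fun j _ => ?_
  ring

/-- energy conservation for an ideal barotropic fluid on the 3-torus: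
H(t) = ∫_{[0,1]³} (|V|²/2 + ε(ρ)) ρ is constant in time, where (r ε(r))' = h(r). -/
theorem energy_conservation (V : ℝ × R3 → R3) (ρ : ℝ × R3 → ℝ) (h ε : ℝ → ℝ)
    (hV : ContDiff ℝ 2 V) (hρ : ContDiff ℝ 2 ρ)
    (hVper : ∀ (t : ℝ) (x : R3) (k : Fin 3 → ℤ), V (t, x + fun i => (k i : ℝ)) = V (t, x))
    (hρper : ∀ (t : ℝ) (x : R3) (k : Fin 3 → ℤ), ρ (t, x + fun i => (k i : ℝ)) = ρ (t, x))
    (hρpos : ∀ (t : ℝ) (x : R3), 0 < ρ (t, x))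
    (hh : ContDiff ℝ 1 h) (hε : ContDiff ℝ 1 ε)
    (henth : ∀ r : ℝ, 0 < r → deriv (fun s => s * ε s) r = h r)
    (hcont : ∀ (t : ℝ) (x : R3),
      deriv (fun s => ρ (s, x)) t + div3 (fun y => ρ (t, y) • V (t, y)) x = 0)
    (hmom : ∀ (t : ℝ) (x : R3),
      deriv (fun s => V (s, x)) t
        + (fun i => dot3 (V (t, x)) (grad3 (fun y => V (t, y) i) x))
        = -grad3 (fun y => h (ρ (t, y))) x) :
    ∀ t₁ t₂ : ℝ,
      (∫ x in Set.Icc (0 : R3) 1,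
        (dot3 (V (t₁, x)) (V (t₁, x)) / 2 + ε (ρ (t₁, x))) * ρ (t₁, x))
      = ∫ x in Set.Icc (0 : R3) 1,
        (dot3 (V (t₂, x)) (V (t₂, x)) / 2 + ε (ρ (t₂, x))) * ρ (t₂, x) := by
  have hV1 : ContDiff ℝ 1 V := hV.of_le one_le_two
  have hρ1 : ContDiff ℝ 1 ρ := hρ.of_le one_le_two
  have hhρ : ContDiff ℝ 1 fun p => h (ρ p) := hh.comp hρ1
  have hVV : ContDiff ℝ 1 fun p => dot3 (V p) (V p) / 2 :=
    (ContDiff.sum fun i _ => (contDiff_pi.1 hV1 i).mul (contDiff_pi.1 hV1 i)).div_const 2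
  have hF : ContDiff ℝ 1 fun p => (dot3 (V p) (V p) / 2 + ε (ρ p)) * ρ p :=
    (hVV.add (hε.comp hρ1)).mul hρ1
  have hderiv : ∀ t x, fderiv ℝ (fun p => (dot3 (V p) (V p) / 2 + ε (ρ p)) * ρ p) (t, x) (1, 0)
      = -div3 (fun y => (dot3 (V (t, y)) (V (t, y)) / 2 + h (ρ (t, y))) •
          (ρ (t, y) • V (t, y))) x := by
    intro t x
    have hx : ∀ {E : Type} [NormedAddCommGroup E] [NormedSpace ℝ E] {f : ℝ × R3 → E},
        ContDiff ℝ 1 f → DifferentiableAt ℝ (fun y => f (t, y)) x := fun hf =>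
      (hf.comp (contDiff_prodMk_right t)).differentiable one_ne_zero x
    have ht : ∀ {E : Type} [NormedAddCommGroup E] [NormedSpace ℝ E] {f : ℝ × R3 → E},
        ContDiff ℝ 1 f → DifferentiableAt ℝ (fun s => f (s, x)) t := fun hf =>
      (hf.comp (contDiff_prodMk_left x)).differentiable one_ne_zero t
    have hρt := (ht hρ1).hasDerivAt
    have hVt := fun j => hasDerivAt_pi.1 (ht hV1).hasDerivAt j
    have hthermal : HasDerivAt (fun s => ρ (s, x) * ε (ρ (s, x)))
        (h (ρ (t, x)) * deriv (fun s => ρ (s, x)) t) t := by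
      have hr : HasDerivAt (fun s => s * ε s) (h (ρ (t, x))) (ρ (t, x)) := by
        rw [← henth _ (hρpos t x)]
        exact (differentiableAt_id.mul (hε.differentiable one_ne_zero _)).hasDerivAt
      exact hr.comp t hρt
    have hkin : HasDerivAt (fun s => (∑ j, V (s, x) j * V (s, x) j) * (1 / 2)) _ t :=
      (HasDerivAt.fun_sum (u := Finset.univ) fun j _ => (hVt j).mul (hVt j)).mul_const (1 / 2)
    have htot := ((hkin.mul hρt).add hthermal).congr_of_eventuallyEq
      (f₁ := fun s => (dot3 (V (s, x)) (V (s, x)) / 2 + ε (ρ (s, x))) * ρ (s, x))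
      (Filter.Eventually.of_forall fun s => by simp [dot3]; ring)
    have hfd := ((hF.differentiable one_ne_zero (t, x)).hasFDerivAt).comp_hasDerivAt t
      ((hasDerivAt_id t).prodMk (hasDerivAt_const t x))
    rw [hfd.unique htot, div3_smul
      (f := fun y => dot3 (V (t, y)) (V (t, y)) / 2 + h (ρ (t, y)))
      (W := fun y => ρ (t, y) • V (t, y))
      ((hx hVV).add (hx hhρ)) ((hx hρ1).smul (hx hV1))]
    have hgrad : ∀ i, grad3 (fun y => dot3 (V (t, y)) (V (t, y)) / 2 + h (ρ (t, y))) x i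
        = ∑ j, V (t, x) j * pd3 i (fun y => V (t, y) j) x
          + pd3 i (fun y => h (ρ (t, y))) x := by
      intro i
      rw [← pd3_dot3_self_div_two (hx hV1)]
      simp [grad3, pd3, fderiv_fun_add (hx hVV) (hx hhρ)]
    have hm := fun i => congrFun (hmom t x) i
    have hc := hcont t x
    generalize div3 (fun y => ρ (t, y) • V (t, y)) x = D at hc ⊢
    rw [funext hgrad]
    simp only [dot3, grad3, Pi.add_apply, Pi.neg_apply, Fin.sum_univ_three, Pi.smul_apply,
      smul_eq_mul] at hm ⊢
    linear_combination ((V (t, x) 0 ^ 2 + V (t, x) 1 ^ 2 + V (t, x) 2 ^ 2) / 2 + h (ρ (t, x))) * hc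
      + ρ (t, x) * (V (t, x) 0 * hm 0 + V (t, x) 1 * hm 1 + V (t, x) 2 * hm 2)
  have hzero : ∀ t, ∫ x in Set.Icc (0 : R3) 1,
      fderiv ℝ (fun p => (dot3 (V p) (V p) / 2 + ε (ρ p)) * ρ p) (t, x) (1, 0) = 0 := by
    intro t
    simp only [hderiv, integral_neg, neg_eq_zero]
    refine integral_div3_eq_zero_of_periodic ?_ fun x k => by simp only [hVper, hρper]
    exact ((hVV.add hhρ).smul (hρ1.smul hV1)).comp (contDiff_prodMk_right t)
  have hH := fun t => hasDerivAt_setIntegral_of_contDiff hF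
    (isCompact_Icc (a := (0 : R3)) (b := 1)) t
  exact is_const_of_deriv_eq_zero (fun t => (hH t).differentiableAt)
    fun t => (hH t).deriv.trans (hzero t)
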